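/- arXiv:1903.07881 — 3 statements merged into one kernel-verified Lean document; each statement's English description precedes it below -/
import Mathlib

section
/- Let V be a finite-dimensional real vector space and let E and F be subspaces of V with s = dim(E ∩ F). Then dim(Sym²(E) ∩ Sym²(F)) = s(s+1)/2. -/
open scoped TensorProduct

/-- The subspace of `V ⊗ V` consisting of tensors fixed by the flip map `a ⊗ b ↦ b ⊗ a`. -/
noncomputable def flipFixed (V : Type*) [AddCommGroup V] [Module ℝ V] :
    Submodule ℝ (V ⊗[ℝ] V) :=
  LinearMap.ker ((TensorProduct.comm ℝ V V).toLinearMap - LinearMap.id)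

/-- `Sym²(W)` for a subspace `W ⊆ V`: the flip-fixed tensors of `V ⊗ V` lying in the
canonical image of `W ⊗ W` in `V ⊗ V`. -/
noncomputable def sym2Sub {V : Type*} [AddCommGroup V] [Module ℝ V]
    (W : Submodule ℝ V) : Submodule ℝ (V ⊗[ℝ] V) :=
  LinearMap.range (TensorProduct.map W.subtype W.subtype) ⊓ flipFixed V

section

variable {V : Type*} [AddCommGroup V] [Module ℝ V]

theorem mem_flipFixed {x : V ⊗[ℝ] V} : x ∈ flipFixed V ↔ TensorProduct.comm ℝ V V x = x := by
  simp [flipFixed, sub_eq_zero]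

/-- There is an endomorphism of `V` that fixes `E` pointwise and maps `F` into `E ⊓ F`. -/
theorem exists_projection_map_le_inf (E F : Submodule ℝ V) :
    ∃ p : V →ₗ[ℝ] V, (∀ x ∈ E, p x = x) ∧ ∀ x ∈ F, p x ∈ E ⊓ F := by
  obtain ⟨C, hdisj, hsup⟩ := exists_isCompl ((E ⊓ F).submoduleOf F)
  have hEC : Disjoint E (C.map F.subtype) := by
    rw [Submodule.disjoint_def]
    rintro _ hx ⟨y, hy, rfl⟩
    have := Submodule.disjoint_def.1 hdisj y ⟨hx, y.2⟩ hy
    simp [this]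
  obtain ⟨D, hCD, hDE⟩ := hEC.symm.exists_isCompl
  refine ⟨E.subtype ∘ₗ E.projectionOnto D hDE.symm, fun x hx ↦ ?_, fun x hx ↦ ?_⟩
  · simp [Submodule.projection_apply_of_mem_left hDE.symm hx]
  · obtain ⟨g, hg, c, hc, hgc⟩ :=
      Submodule.mem_sup.1 ((codisjoint_iff.1 hsup).ge trivial :
        (⟨x, hx⟩ : F) ∈ (E ⊓ F).submoduleOf F ⊔ C)
    have hg' : (g : V) ∈ E ⊓ F := hg
    have hc' : (c : V) ∈ D := hCD ⟨c, hc, rfl⟩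
    have hx' : x = g + c := congrArg Subtype.val hgc.symm
    have : (E.subtype ∘ₗ E.projectionOnto D hDE.symm) x = g := by
      rw [hx', map_add, LinearMap.comp_apply, LinearMap.comp_apply,
        Submodule.projectionOnto_apply_of_mem_left _ hg'.1,
        Submodule.projectionOnto_apply_of_mem_right _ hc']
      simp
    rwa [this]

/-- The images of `E ⊗ E` and `F ⊗ F` intersect in the image of `(E ⊓ F) ⊗ (E ⊓ F)`. -/
theorem range_map_subtype_inf (E F : Submodule ℝ V) :
    LinearMap.range (TensorProduct.map E.subtype E.subtype) ⊓
        LinearMap.range (TensorProduct.map F.subtype F.subtype) =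
      LinearMap.range (TensorProduct.map (E ⊓ F).subtype (E ⊓ F).subtype) := by
  apply le_antisymm
  · obtain ⟨p, hpE, hpF⟩ := exists_projection_map_le_inf E F
    rintro _ ⟨⟨y, rfl⟩, ⟨z, hz⟩⟩
    have hE : TensorProduct.map p p ∘ₗ TensorProduct.map E.subtype E.subtype =
        TensorProduct.map E.subtype E.subtype := by
      ext a b
      simp [hpE]
    have hF : TensorProduct.map p p ∘ₗ TensorProduct.map F.subtype F.subtype =
        TensorProduct.map (E ⊓ F).subtype (E ⊓ F).subtype ∘ₗ
          TensorProduct.map (p.restrict hpF) (p.restrict hpF) := by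
      ext a b
      simp
    refine ⟨TensorProduct.map (p.restrict hpF) (p.restrict hpF) z, ?_⟩
    rw [← LinearMap.comp_apply, ← hF, LinearMap.comp_apply, hz, ← LinearMap.comp_apply, hE]
  · have key {A B : Submodule ℝ V} (h : A ≤ B) :
        LinearMap.range (TensorProduct.map A.subtype A.subtype) ≤
          LinearMap.range (TensorProduct.map B.subtype B.subtype) := by
      rw [← Submodule.subtype_comp_inclusion A B h, TensorProduct.map_comp]
      exact LinearMap.range_comp_le_range _ _
    exact le_inf (key inf_le_left) (key inf_le_right)

theorem sym2Sub_inf (E F : Submodule ℝ V) : sym2Sub E ⊓ sym2Sub F = sym2Sub (E ⊓ F) := by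
  rw [sym2Sub, sym2Sub, sym2Sub, ← range_map_subtype_inf, inf_inf_inf_comm, inf_idem]

theorem map_subtype_injective (W : Submodule ℝ V) :
    Function.Injective (TensorProduct.map W.subtype W.subtype) :=
  TensorProduct.map_injective_of_flat_flat _ _ W.subtype_injective W.subtype_injective

theorem sym2Sub_eq_map_flipFixed (W : Submodule ℝ V) :
    sym2Sub W = (flipFixed W).map (TensorProduct.map W.subtype W.subtype) := by
  ext x
  constructor
  · rintro ⟨⟨y, rfl⟩, hy⟩
    refine ⟨y, mem_flipFixed.2 (map_subtype_injective W ?_), rfl⟩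
    rw [TensorProduct.map_comm]
    exact mem_flipFixed.1 hy
  · rintro ⟨y, hy, rfl⟩
    refine ⟨⟨y, rfl⟩, mem_flipFixed.2 ?_⟩
    rw [← TensorProduct.map_comm, mem_flipFixed.1 hy]

theorem tensorProduct_repr_comm {ι : Type*} (b : Module.Basis ι ℝ V) (x : V ⊗[ℝ] V) (i j : ι) :
    (b.tensorProduct b).repr (TensorProduct.comm ℝ V V x) (i, j) =
      (b.tensorProduct b).repr x (j, i) := by
  induction x with
  | zero => simp
  | tmul v w => simp [mul_comm]
  | add x y hx hy => simp [hx, hy]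

theorem finrank_flipFixed [FiniteDimensional ℝ V] :
    Module.finrank ℝ (flipFixed V) =
      Module.finrank ℝ V * (Module.finrank ℝ V + 1) / 2 := by
  let b := Module.finBasis ℝ V
  let e := (b.tensorProduct b).equivFun
  let f := LinearMap.funLeft ℝ ℝ (Sym2.mk (α := Fin (Module.finrank ℝ V))).uncurry
  have hf : Function.Injective f :=
    LinearMap.funLeft_injective_of_surjective _ _ _ Sym2.mk_surjective
  have hrange : LinearMap.range (e.symm.toLinearMap ∘ₗ f) = flipFixed V := by
    ext x
    rw [mem_flipFixed]
    constructor
    · rintro ⟨g, rfl⟩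
      refine e.injective (funext fun ⟨i, j⟩ ↦ ?_)
      have h (k) : e (e.symm (f g)) k = f g k := congrFun (e.apply_symm_apply (f g)) k
      calc
        _ = e (e.symm (f g)) (j, i) := tensorProduct_repr_comm b _ i j
        _ = e (e.symm (f g)) (i, j) := by
          rw [h, h]
          exact congrArg g Sym2.eq_swap
    · intro hx
      have hsymm (i j) : e x (i, j) = e x (j, i) := by
        conv_lhs => rw [← hx]
        exact tensorProduct_repr_comm b x i j
      refine ⟨Sym2.lift ⟨fun i j ↦ e x (i, j), hsymm⟩, e.injective ?_⟩
      rw [LinearMap.comp_apply, LinearEquiv.coe_coe, e.apply_symm_apply]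
      rfl
  have hinj : Function.Injective (e.symm.toLinearMap ∘ₗ f) := e.symm.injective.comp hf
  rw [← hrange, LinearMap.finrank_range_of_inj hinj]
  simp [Sym2.card, Nat.choose_two_right, mul_comm]

end

/-- For subspaces `E, F` of a finite-dimensional real vector space `V` with
`s = dim (E ∩ F)`, one has `dim (Sym²(E) ∩ Sym²(F)) = s (s + 1) / 2`. -/
theorem finrank_sym2_inf (V : Type*) [AddCommGroup V] [Module ℝ V] [FiniteDimensional ℝ V]
    (E F : Submodule ℝ V) (s : ℕ) (hs : s = Module.finrank ℝ ↥(E ⊓ F)) :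
    Module.finrank ℝ ↥(sym2Sub E ⊓ sym2Sub F) = s * (s + 1) / 2 := by
  rw [sym2Sub_inf, sym2Sub_eq_map_flipFixed, hs, ← finrank_flipFixed]
  exact (Submodule.equivMapOfInjective _
    (map_subtype_injective (E ⊓ F)) (flipFixed ↥(E ⊓ F))).finrank_eq.symm
end

section
/- Let m ≥ 1 and let P¹_i, P²_i, X_i, V_i : ℝ^m → ℝ (for i = 1, …, m) be continuously differentiable functions. Assume that for every x ∈ ℝ^m and for c = 1, 2: Σ_{i=1}^m P^c_i(x)(V_i(x) − X_i(x)) = 0. Then for every x ∈ ℝ^m: Σ_{i=1}^m Σ_{i₁=1}^m (P¹_{i₁}(x)P²_i(x) − P¹_i(x)P²_{i₁}(x)) ∂_i V_{i₁}(x) = Σ_{i=1}^m Σ_{i₁=1}^m [P¹_i(x) ∂_i P²_{i₁}(x) − P²_i(x) ∂_i P¹_{i₁}(x)](V_{i₁}(x) − X_{i₁}(x)) + Σ_{i=1}^m Σ_{i₁=1}^m [P²_i(x)P¹_{i₁}(x) − P¹_i(x)P²_{i₁}(x)] ∂_i X_{i₁}(x). -/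
/-- The partial derivative `∂_i f` of `f : ℝ^m → ℝ` with respect to the `i`-th coordinate. -/
noncomputable def pd {m : ℕ} (f : (Fin m → ℝ) → ℝ) (i : Fin m) (x : Fin m → ℝ) : ℝ :=
  fderiv ℝ f x (Pi.single i 1)

/-- Differentiating the identity `Σ_j P_j (V_j − X_j) = 0` in the `i`-th direction. -/
lemma sum_pd_mul_sub_eq_zero {m : ℕ} {P X V : Fin m → (Fin m → ℝ) → ℝ}
    (hP : ∀ i, Differentiable ℝ (P i)) (hX : ∀ i, Differentiable ℝ (X i))
    (hV : ∀ i, Differentiable ℝ (V i))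
    (h : ∀ x : Fin m → ℝ, ∑ j, P j x * (V j x - X j x) = 0) (x : Fin m → ℝ) (i : Fin m) :
    ∑ j, (P j x * (pd (V j) i x - pd (X j) i x) + pd (P j) i x * (V j x - X j x)) = 0 := by
  have hd : HasFDerivAt (fun y => ∑ j, P j y * (V j y - X j y)) _ x :=
    HasFDerivAt.fun_sum fun j _ =>
      (hP j x).hasFDerivAt.mul ((hV j x).hasFDerivAt.sub (hX j x).hasFDerivAt)
  simp only [h] at hd
  have happ := DFunLike.congr_fun (hd.unique (hasFDerivAt_const 0 x)) (Pi.single i 1)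
  simpa [pd, mul_comm] using happ

/-- If `Σ_i P^c_i (V_i − X_i) = 0` identically for `c = 1, 2`, then
`Σ_i Σ_{i₁} (P¹_{i₁} P²_i − P¹_i P²_{i₁}) ∂_i V_{i₁}
  = Σ_i Σ_{i₁} (P¹_i ∂_i P²_{i₁} − P²_i ∂_i P¹_{i₁}) (V_{i₁} − X_{i₁})
    + Σ_i Σ_{i₁} (P²_i P¹_{i₁} − P¹_i P²_{i₁}) ∂_i X_{i₁}`. -/
theorem curvature_identity
    (m : ℕ) (hm : 1 ≤ m)
    (P₁ P₂ X V : Fin m → (Fin m → ℝ) → ℝ)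
    (hP₁ : ∀ i, ContDiff ℝ 1 (P₁ i)) (hP₂ : ∀ i, ContDiff ℝ 1 (P₂ i))
    (hX : ∀ i, ContDiff ℝ 1 (X i)) (hV : ∀ i, ContDiff ℝ 1 (V i))
    (h₁ : ∀ x : Fin m → ℝ, ∑ i, P₁ i x * (V i x - X i x) = 0)
    (h₂ : ∀ x : Fin m → ℝ, ∑ i, P₂ i x * (V i x - X i x) = 0) :
    ∀ x : Fin m → ℝ,
      ∑ i, ∑ i₁, (P₁ i₁ x * P₂ i x - P₁ i x * P₂ i₁ x) * pd (V i₁) i x =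
        (∑ i, ∑ i₁, (P₁ i x * pd (P₂ i₁) i x - P₂ i x * pd (P₁ i₁) i x) * (V i₁ x - X i₁ x)) +
          ∑ i, ∑ i₁, (P₂ i x * P₁ i₁ x - P₁ i x * P₂ i₁ x) * pd (X i₁) i x := by
  intro x
  have hD₁ := sum_pd_mul_sub_eq_zero (fun i => (hP₁ i).differentiable one_ne_zero)
    (fun i => (hX i).differentiable one_ne_zero) (fun i => (hV i).differentiable one_ne_zero) h₁ x
  have hD₂ := sum_pd_mul_sub_eq_zero (fun i => (hP₂ i).differentiable one_ne_zero)
    (fun i => (hX i).differentiable one_ne_zero) (fun i => (hV i).differentiable one_ne_zero) h₂ x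
  rw [← Finset.sum_add_distrib]
  refine Finset.sum_congr rfl fun i _ => ?_
  rw [← sub_eq_zero, ← Finset.sum_add_distrib, ← Finset.sum_sub_distrib]
  have hcomb := congrArg₂ (fun a b => P₂ i x * a - P₁ i x * b) (hD₁ i) (hD₂ i)
  simp only [Finset.mul_sum, ← Finset.sum_sub_distrib, mul_zero, sub_zero] at hcomb
  rw [← hcomb]
  exact Finset.sum_congr rfl fun j _ => by ring
end

section
/- Let m ≥ 1, n ≥ 1, and let P_{i,q}, V_i : ℝ^m → ℝ (for i = 1, …, m and q = 1, …, n) be continuously differentiable functions. Assume that for every x ∈ ℝ^m and every q = 1, …, n: Σ_{i=1}^m P_{i,q}(x) V_i(x) = 0. Then for all q₁, q₂ ∈ {1, …, n} and every x ∈ ℝ^m: Σ_{i=1}^m Σ_{i₁=1}^m (P_{i,q₁}(x)P_{i₁,q₂}(x) − P_{i,q₂}(x)P_{i₁,q₁}(x)) ∂_i V_{i₁}(x) = Σ_{i₁=1}^m ( Σ_{i=1}^m [P_{i,q₂}(x) ∂_i P_{i₁,q₁}(x) − P_{i,q₁}(x) ∂_i P_{i₁,q₂}(x)] ) V_{i₁}(x).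 -/
/-- The Leibniz rule applied to an identically vanishing sum of products. -/
theorem sum_pd_mul_add_mul_pd_eq_zero {m : ℕ} {ι : Type*} [Fintype ι]
    {f g : ι → (Fin m → ℝ) → ℝ} (hf : ∀ j, Differentiable ℝ (f j))
    (hg : ∀ j, Differentiable ℝ (g j)) (h : ∀ x, ∑ j, f j x * g j x = 0)
    (i : Fin m) (x : Fin m → ℝ) :
    ∑ j, (f j x * pd (g j) i x + pd (f j) i x * g j x) = 0 := by
  have hd := HasFDerivAt.fun_sum (u := Finset.univ)
    fun j _ => (hf j x).hasFDerivAt.mul (hg j x).hasFDerivAt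
  have hz : HasFDerivAt (fun y => ∑ j, f j y * g j y) (0 : (Fin m → ℝ) →L[ℝ] ℝ) x := by
    simpa only [h] using hasFDerivAt_const (0 : ℝ) x
  have key := DFunLike.congr_fun (hd.unique hz) (Pi.single i 1)
  simpa [pd, mul_comm] using key

/-- If `Σ_i P_{i,q} V_i = 0` identically for every `q`, then for all `q₁, q₂`:
`Σ_i Σ_{i₁} (P_{i,q₁} P_{i₁,q₂} − P_{i,q₂} P_{i₁,q₁}) ∂_i V_{i₁}
  = Σ_{i₁} ( Σ_i (P_{i,q₂} ∂_i P_{i₁,q₁} − P_{i,q₁} ∂_i P_{i₁,q₂}) ) V_{i₁}`. -/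
theorem connection_curvature_identity
    (m n : ℕ) (hm : 1 ≤ m) (hn : 1 ≤ n)
    (P : Fin m → Fin n → (Fin m → ℝ) → ℝ) (V : Fin m → (Fin m → ℝ) → ℝ)
    (hP : ∀ i q, ContDiff ℝ 1 (P i q)) (hV : ∀ i, ContDiff ℝ 1 (V i))
    (h : ∀ (x : Fin m → ℝ) (q : Fin n), ∑ i, P i q x * V i x = 0) :
    ∀ (q₁ q₂ : Fin n) (x : Fin m → ℝ),
      ∑ i, ∑ i₁, (P i q₁ x * P i₁ q₂ x - P i q₂ x * P i₁ q₁ x) * pd (V i₁) i x =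
        ∑ i₁, (∑ i, (P i q₂ x * pd (P i₁ q₁) i x - P i q₁ x * pd (P i₁ q₂) i x)) * V i₁ x := by
  intro q₁ q₂ x
  have leibniz (q : Fin n) (i : Fin m) :=
    sum_pd_mul_add_mul_pd_eq_zero (fun j => (hP j q).differentiable one_ne_zero)
      (fun j => (hV j).differentiable one_ne_zero) (fun y => h y q) i x
  simp only [Finset.sum_mul]
  rw [Finset.sum_comm (f := fun i₁ i =>
    (P i q₂ x * pd (P i₁ q₁) i x - P i q₁ x * pd (P i₁ q₂) i x) * V i₁ x)]
  refine Finset.sum_congr rfl fun i _ => ?_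
  rw [← sub_eq_zero, ← Finset.sum_sub_distrib]
  calc
    _ = P i q₁ x * ∑ j, (P j q₂ x * pd (V j) i x + pd (P j q₂) i x * V j x) -
        P i q₂ x * ∑ j, (P j q₁ x * pd (V j) i x + pd (P j q₁) i x * V j x) := by
      rw [Finset.mul_sum, Finset.mul_sum, ← Finset.sum_sub_distrib]
      exact Finset.sum_congr rfl fun j _ => by ring
    _ = 0 := by rw [leibniz q₁ i, leibniz q₂ i]; ring
end
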